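/- arXiv:1112.0284 — 2 statements merged into one kernel-verified Lean document; each statement's English description precedes it below -/
import Mathlib

section
/- Let (V,g) be a pseudo-Euclidean space of dimension n ≥ 3, let v be a smooth conformal vector field on (V,g) with conformal factor φ : V → ℝ, and let Z = {x ∈ V : v(x) = 0} be the zero set of v, equipped with the subspace topology. If x, y ∈ Z lie in the same connected component of Z, then charpoly(Dv_x) = charpoly(Dv_y) and φ(x) = φ(y). -/
/-- Two endomorphisms of a real vector space have the same characteristic polynomial as soon as
the evaluations agree away from one point. -/
theorem charpoly_eq_of_forall_det {V : Type*} [AddCommGroup V] [Module ℝ V]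
    [FiniteDimensional ℝ V] {A B : Module.End ℝ V} (c : ℝ)
    (h : ∀ t : ℝ, t ≠ c →
      LinearMap.det (algebraMap ℝ (Module.End ℝ V) t - A) =
        LinearMap.det (algebraMap ℝ (Module.End ℝ V) t - B)) :
    A.charpoly = B.charpoly := by
  refine Polynomial.eq_of_infinite_eval_eq _ _ ((Set.finite_singleton c).infinite_compl.mono ?_)
  intro t ht
  simpa [LinearMap.eval_charpoly] using h t ht

/-- The resolvent determinant of a square-zero endomorphism. -/
theorem det_algebraMap_sub_of_mul_self_eq_zero {V : Type*} [AddCommGroup V] [Module ℝ V]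
    [FiniteDimensional ℝ V] {N : Module.End ℝ V} (hN : N * N = 0) (t : ℝ) :
    LinearMap.det (algebraMap ℝ (Module.End ℝ V) t - N) = t ^ Module.finrank ℝ V := by
  have h : IsNilpotent N := ⟨2, by rw [pow_two, hN]⟩
  rw [← LinearMap.eval_charpoly, h.charpoly_eq_X_pow_finrank]
  simp

/-- Adding a square-zero endomorphism whose range consists of eigenvectors of `A` for a common
eigenvalue does not change the characteristic polynomial. -/
theorem charpoly_add_eq_of_mul_eq_smul {V : Type*} [AddCommGroup V] [Module ℝ V]
    [FiniteDimensional ℝ V] {A N : Module.End ℝ V} (c : ℝ) (hAN : A * N = c • N)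
    (hN : N * N = 0) : (A + N).charpoly = A.charpoly := by
  refine charpoly_eq_of_forall_det c fun t ht ↦ ?_
  have key : (algebraMap ℝ (Module.End ℝ V) t - A) * (algebraMap ℝ (Module.End ℝ V) (t - c) - N) =
      (t - c) • (algebraMap ℝ (Module.End ℝ V) t - (A + N)) := by
    simp only [Algebra.algebraMap_eq_smul_one, sub_mul, mul_sub, smul_mul_assoc, mul_smul_comm,
      one_mul, mul_one, hAN]
    module
  have hdet := congrArg LinearMap.det key
  rw [map_mul, LinearMap.det_smul, det_algebraMap_sub_of_mul_self_eq_zero hN, mul_comm] at hdet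
  exact (mul_left_cancel₀ (pow_ne_zero _ (sub_ne_zero.2 ht)) hdet).symm

/-- Dual version of `charpoly_add_eq_of_mul_eq_smul`, with the product in the other order. -/
theorem charpoly_add_eq_of_mul_eq_smul' {V : Type*} [AddCommGroup V] [Module ℝ V]
    [FiniteDimensional ℝ V] {A N : Module.End ℝ V} (c : ℝ) (hNA : N * A = c • N)
    (hN : N * N = 0) : (A + N).charpoly = A.charpoly := by
  refine charpoly_eq_of_forall_det c fun t ht ↦ ?_
  have key : (algebraMap ℝ (Module.End ℝ V) (t - c) - N) * (algebraMap ℝ (Module.End ℝ V) t - A) =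
      (t - c) • (algebraMap ℝ (Module.End ℝ V) t - (A + N)) := by
    simp only [Algebra.algebraMap_eq_smul_one, sub_mul, mul_sub, smul_mul_assoc, mul_smul_comm,
      one_mul, mul_one, hNA]
    module
  have hdet := congrArg LinearMap.det key
  rw [map_mul, LinearMap.det_smul, det_algebraMap_sub_of_mul_self_eq_zero hN] at hdet
  exact (mul_left_cancel₀ (pow_ne_zero _ (sub_ne_zero.2 ht)) hdet).symm

/-- Conjugating by an involution does not change the characteristic polynomial. -/
theorem charpoly_eq_of_involution {V : Type*} [AddCommGroup V] [Module ℝ V]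
    [FiniteDimensional ℝ V] {A B R : Module.End ℝ V} (hR : R * R = 1) (h : B * R = R * A) :
    B.charpoly = A.charpoly := by
  have hd : LinearMap.det R * LinearMap.det R = 1 := by rw [← map_mul, hR, map_one]
  refine charpoly_eq_of_forall_det 0 fun t _ ↦ ?_
  have key : (algebraMap ℝ (Module.End ℝ V) t - B) * R =
      R * (algebraMap ℝ (Module.End ℝ V) t - A) := by
    rw [sub_mul, mul_sub, h, Algebra.commutes]
  have hdet := congrArg LinearMap.det key
  rw [map_mul, map_mul, mul_comm] at hdet
  exact mul_left_cancel₀ (left_ne_zero_of_mul_eq_one hd) hdet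

/-- A nondegenerate symmetric bilinear form has an orthogonal basis of non-null vectors. -/
theorem exists_orthogonal_basis_apply_self_ne_zero {V : Type*} [AddCommGroup V] [Module ℝ V]
    [FiniteDimensional ℝ V] (g : V →ₗ[ℝ] V →ₗ[ℝ] ℝ) (hg_symm : ∀ x y : V, g x y = g y x)
    (hg_nondeg : ∀ x : V, (∀ y : V, g x y = 0) → x = 0) :
    ∃ e : Module.Basis (Fin (Module.finrank ℝ V)) ℝ V,
      (∀ i j, i ≠ j → g (e i) (e j) = 0) ∧ ∀ i, g (e i) (e i) ≠ 0 := by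
  obtain ⟨e, he⟩ := LinearMap.BilinForm.exists_orthogonal_basis (B := g) ⟨fun x y ↦ hg_symm x y⟩
  have hij : ∀ i j, i ≠ j → g (e i) (e j) = 0 := fun i j h ↦ he h
  refine ⟨e, hij, fun i hi ↦ e.ne_zero i (hg_nondeg _ fun y ↦ ?_)⟩
  have h0 : g (e i) = 0 := by
    refine e.ext fun j ↦ ?_
    by_cases h : i = j
    · subst h; simpa using hi
    · simpa using hij i j h
  simp [h0]

/-- In dimension at least three, the only symmetric bilinear form `H` whose Kulkarni–Nomizu
product with a nondegenerate symmetric form `g` vanishes is zero. -/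
theorem bilinear_eq_zero_of_kulkarniNomizu {V : Type*} [AddCommGroup V] [Module ℝ V]
    [FiniteDimensional ℝ V] (hn : 3 ≤ Module.finrank ℝ V) (g H : V →ₗ[ℝ] V →ₗ[ℝ] ℝ)
    (hg_symm : ∀ x y : V, g x y = g y x)
    (hg_nondeg : ∀ x : V, (∀ y : V, g x y = 0) → x = 0)
    (h : ∀ p w y z : V, H p y * g w z - H p z * g w y = H w y * g p z - H w z * g p y) :
    H = 0 := by
  obtain ⟨e, he, he'⟩ := exists_orthogonal_basis_apply_self_ne_zero g hg_symm hg_nondeg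
  have exists_third : ∀ i j : Fin (Module.finrank ℝ V), ∃ k, k ≠ i ∧ k ≠ j := by
    intro i j
    have hc : ({i, j} : Finset (Fin (Module.finrank ℝ V))).card < (Finset.univ : Finset (Fin (Module.finrank ℝ V))).card := by
      rw [Finset.card_univ, Fintype.card_fin]
      exact (Finset.card_le_two).trans_lt hn
    obtain ⟨k, -, hk⟩ := Finset.exists_mem_notMem_of_card_lt_card hc
    simp only [Finset.mem_insert, Finset.mem_singleton, not_or] at hk
    exact ⟨k, hk⟩
  have off : ∀ i j, i ≠ j → H (e i) (e j) = 0 := by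
    intro i j hij
    obtain ⟨k, hki, hkj⟩ := exists_third i j
    have := h (e i) (e k) (e j) (e k)
    rw [he k j hkj, he i k hki.symm, he i j hij] at this
    simpa [he' k] using this
  have diag : ∀ i k, i ≠ k →
      H (e i) (e i) / g (e i) (e i) = - (H (e k) (e k) / g (e k) (e k)) := by
    intro i k hik
    have := h (e i) (e k) (e i) (e k)
    rw [off i k hik, off k i hik.symm] at this
    have h1 := he' i
    have h2 := he' k
    field_simp
    linarith
  refine LinearMap.ext_basis e e fun i j ↦ ?_
  by_cases hij : i = j
  · subst hij
    obtain ⟨k, hk, -⟩ := exists_third i i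
    obtain ⟨l, hl, hlk⟩ := exists_third i k
    have h0 : H (e i) (e i) / g (e i) (e i) = 0 := by
      linarith [diag i k hk.symm, diag i l hl.symm, diag k l hlk.symm]
    simpa [he' i] using h0
  · simpa using off i j hij

theorem hasFDerivAt_apply_const {V F : Type*} [NormedAddCommGroup V] [NormedSpace ℝ V]
    [NormedAddCommGroup F] [NormedSpace ℝ F]
    {f : V → V →L[ℝ] F} {f' : V →L[ℝ] V →L[ℝ] F} {x : V} (hf : HasFDerivAt f f' x) (y : V) :
    HasFDerivAt (fun p ↦ f p y) (f'.flip y) x := by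
  simpa using hf.clm_apply (hasFDerivAt_const y x)

section Conformal

variable {V : Type*} [NormedAddCommGroup V] [NormedSpace ℝ V] [FiniteDimensional ℝ V]

theorem hasFDerivAt_bilinear_apply (g : V →ₗ[ℝ] V →ₗ[ℝ] ℝ) {f : V → V} {f' : V →L[ℝ] V} {x : V}
    (hf : HasFDerivAt f f' x) (z : V) :
    HasFDerivAt (fun p ↦ g (f p) z) ((LinearMap.toContinuousLinearMap (g.flip z)).comp f') x :=
  (LinearMap.toContinuousLinearMap (g.flip z)).hasFDerivAt.comp x hf

/-- The conformal factor of a smooth conformal vector field is smooth. -/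
theorem contDiff_conformalFactor (hn : 3 ≤ Module.finrank ℝ V) (g : V →ₗ[ℝ] V →ₗ[ℝ] ℝ)
    (hg_symm : ∀ x y : V, g x y = g y x)
    (hg_nondeg : ∀ x : V, (∀ y : V, g x y = 0) → x = 0)
    {v : V → V} (hv : ContDiff ℝ (⊤ : ℕ∞) v) {φ : V → ℝ}
    (hconf : ∀ x y z : V,
      g (fderiv ℝ v x y) z + g y (fderiv ℝ v x z) = φ x * g y z) :
    ContDiff ℝ (⊤ : ℕ∞) φ := by
  obtain ⟨e, -, he⟩ := exists_orthogonal_basis_apply_self_ne_zero g hg_symm hg_nondeg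
  set a := e ⟨0, by omega⟩ with ha
  have ha0 : g a a ≠ 0 := he _
  have hφ : φ = fun x ↦ LinearMap.toContinuousLinearMap (g a) (fderiv ℝ v x a) * (2 / g a a) := by
    funext x
    have := hconf x a a
    rw [hg_symm _ a] at this
    simp only [LinearMap.coe_toContinuousLinearMap']
    field_simp
    linarith
  rw [hφ]
  have hF : ContDiff ℝ (⊤ : ℕ∞) (fderiv ℝ v) := hv.fderiv_right (by simp)
  fun_prop

/-- The second derivative of a conformal vector field is determined by the derivative of the
conformal factor. -/
theorem fderiv_fderiv_conformal (g : V →ₗ[ℝ] V →ₗ[ℝ] ℝ)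
    (hg_symm : ∀ x y : V, g x y = g y x)
    {v : V → V} (hv : ContDiff ℝ (⊤ : ℕ∞) v) {φ : V → ℝ} (hφ : ContDiff ℝ (⊤ : ℕ∞) φ)
    (hconf : ∀ x y z : V,
      g (fderiv ℝ v x y) z + g y (fderiv ℝ v x z) = φ x * g y z) (x w y z : V) :
    2 * g (fderiv ℝ (fderiv ℝ v) x w y) z =
      fderiv ℝ φ x w * g y z + fderiv ℝ φ x y * g w z - fderiv ℝ φ x z * g w y := by
  have hF : ContDiff ℝ (⊤ : ℕ∞) (fderiv ℝ v) := hv.fderiv_right (by simp)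
  have hd (y : V) : HasFDerivAt (fun p ↦ fderiv ℝ v p y) ((fderiv ℝ (fderiv ℝ v) x).flip y) x :=
    hasFDerivAt_apply_const ((hF.differentiable (by simp)) x).hasFDerivAt y
  have skew (w y z : V) : g (fderiv ℝ (fderiv ℝ v) x w y) z + g (fderiv ℝ (fderiv ℝ v) x w z) y =
      fderiv ℝ φ x w * g y z := by
    have h1 := (hasFDerivAt_bilinear_apply g (hd y) z).add (hasFDerivAt_bilinear_apply g (hd z) y)
    have h2 := ((hφ.differentiable (by simp)) x).hasFDerivAt.mul_const (g y z)
    have h3 : (fun p ↦ φ p * g y z) =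
        (fun p ↦ g (fderiv ℝ v p y) z) + fun p ↦ g (fderiv ℝ v p z) y := by
      funext p
      rw [← hconf, hg_symm y]
      rfl
    rw [h3] at h2
    have h4 := DFunLike.congr_fun (h1.unique h2) w
    simpa [mul_comm] using h4
  have symm (w y : V) : fderiv ℝ (fderiv ℝ v) x w y = fderiv ℝ (fderiv ℝ v) x y w :=
    (hv.contDiffAt.isSymmSndFDerivAt (by simpa using WithTop.coe_le_coe.2 (le_top : (2 : ℕ∞) ≤ ⊤))) w y
  have s1 := skew w y z
  have s2 := skew y w z
  have s3 := skew z w y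
  rw [symm y w] at s2
  rw [symm z w, symm z y] at s3
  linarith

/-- In dimension at least three, a conformal vector field on a pseudo-Euclidean space has vanishing
third derivative, and its conformal factor has vanishing second derivative. -/
theorem fderiv_fderiv_conformalFactor_eq_zero (hn : 3 ≤ Module.finrank ℝ V)
    (g : V →ₗ[ℝ] V →ₗ[ℝ] ℝ) (hg_symm : ∀ x y : V, g x y = g y x)
    (hg_nondeg : ∀ x : V, (∀ y : V, g x y = 0) → x = 0)
    {v : V → V} (hv : ContDiff ℝ (⊤ : ℕ∞) v) {φ : V → ℝ} (hφ : ContDiff ℝ (⊤ : ℕ∞) φ)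
    (hconf : ∀ x y z : V,
      g (fderiv ℝ v x y) z + g y (fderiv ℝ v x z) = φ x * g y z) (x : V) :
    fderiv ℝ (fderiv ℝ φ) x = 0 := by
  have hF : ContDiff ℝ (⊤ : ℕ∞) (fderiv ℝ v) := hv.fderiv_right (by simp)
  have hG : ContDiff ℝ (⊤ : ℕ∞) (fderiv ℝ (fderiv ℝ v)) := hF.fderiv_right (by simp)
  have hφ' : ContDiff ℝ (⊤ : ℕ∞) (fderiv ℝ φ) := hφ.fderiv_right (by simp)
  have hdφ (y : V) : HasFDerivAt (fun p ↦ fderiv ℝ φ p y) ((fderiv ℝ (fderiv ℝ φ) x).flip y) x :=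
    hasFDerivAt_apply_const ((hφ'.differentiable (by simp)) x).hasFDerivAt y
  have hd (w y : V) : HasFDerivAt (fun p ↦ fderiv ℝ (fderiv ℝ v) p w y)
      (((fderiv ℝ (fderiv ℝ (fderiv ℝ v)) x).flip w).flip y) x :=
    hasFDerivAt_apply_const
      (hasFDerivAt_apply_const ((hG.differentiable (by simp)) x).hasFDerivAt w) y
  have third (p w y z : V) : 2 * g (fderiv ℝ (fderiv ℝ (fderiv ℝ v)) x p w y) z =
      fderiv ℝ (fderiv ℝ φ) x p w * g y z + fderiv ℝ (fderiv ℝ φ) x p y * g w z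
        - fderiv ℝ (fderiv ℝ φ) x p z * g w y := by
    have h1 := (hasFDerivAt_bilinear_apply g (hd w y) z).const_mul 2
    have h2 := (((hdφ w).mul_const (g y z)).add ((hdφ y).mul_const (g w z))).sub
      ((hdφ z).mul_const (g w y))
    have h3 : (fun p ↦ 2 * g (fderiv ℝ (fderiv ℝ v) p w y) z) =
        ((fun p ↦ fderiv ℝ φ p w * g y z) + fun p ↦ fderiv ℝ φ p y * g w z)
          - fun p ↦ fderiv ℝ φ p z * g w y := by
      funext p
      exact fderiv_fderiv_conformal g hg_symm hv hφ hconf p w y z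
    rw [h3] at h1
    have h4 := DFunLike.congr_fun (h1.unique h2) p
    simpa [mul_comm] using h4
  have symmF (p w : V) : fderiv ℝ (fderiv ℝ (fderiv ℝ v)) x p w =
      fderiv ℝ (fderiv ℝ (fderiv ℝ v)) x w p :=
    (hF.contDiffAt.isSymmSndFDerivAt (by simpa using WithTop.coe_le_coe.2 (le_top : (2 : ℕ∞) ≤ ⊤))) p w
  have symmφ (p w : V) : fderiv ℝ (fderiv ℝ φ) x p w = fderiv ℝ (fderiv ℝ φ) x w p :=
    (hφ.contDiffAt.isSymmSndFDerivAt (by simpa using WithTop.coe_le_coe.2 (le_top : (2 : ℕ∞) ≤ ⊤))) p w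
  have hH := bilinear_eq_zero_of_kulkarniNomizu hn g
    ((ContinuousLinearMap.coeLM ℝ).comp (fderiv ℝ (fderiv ℝ φ) x : V →ₗ[ℝ] V →L[ℝ] ℝ))
    hg_symm hg_nondeg (fun p w y z ↦ by
      have h1 := third p w y z
      have h2 := third w p y z
      rw [symmF w p, symmφ w p] at h2
      simp only [LinearMap.comp_apply, ContinuousLinearMap.coe_coe,
        ContinuousLinearMap.coeLM_apply]
      linarith)
  ext p w
  exact LinearMap.congr_fun (LinearMap.congr_fun hH p) w

/-- A conformal vector field on a pseudo-Euclidean space of dimension at least three is a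
quadratic polynomial, expanded here around `a`, and its conformal factor is affine. -/
theorem exists_quadratic_form_of_conformal (hn : 3 ≤ Module.finrank ℝ V)
    (g : V →ₗ[ℝ] V →ₗ[ℝ] ℝ) (hg_symm : ∀ x y : V, g x y = g y x)
    (hg_nondeg : ∀ x : V, (∀ y : V, g x y = 0) → x = 0)
    {v : V → V} (hv : ContDiff ℝ (⊤ : ℕ∞) v) {φ : V → ℝ} (hφ : ContDiff ℝ (⊤ : ℕ∞) φ)
    (hconf : ∀ x y z : V,
      g (fderiv ℝ v x y) z + g y (fderiv ℝ v x z) = φ x * g y z) (a : V) :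
    ∃ u : V, ∀ d : V, φ (a + d) = φ a + g u d ∧
      (∀ z, fderiv ℝ v (a + d) z =
        fderiv ℝ v a z + (1 / 2 : ℝ) • (g u d • z + g u z • d - g d z • u)) ∧
      v (a + d) = v a + fderiv ℝ v a d + (1 / 2 : ℝ) • (g u d • d) - (1 / 4 : ℝ) • (g d d • u) := by
  have hF : ContDiff ℝ (⊤ : ℕ∞) (fderiv ℝ v) := hv.fderiv_right (by simp)
  have hφ' : ContDiff ℝ (⊤ : ℕ∞) (fderiv ℝ φ) := hφ.fderiv_right (by simp)
  have hconst (x : V) : fderiv ℝ φ x = fderiv ℝ φ a :=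
    is_const_of_fderiv_eq_zero (hφ'.differentiable (by simp))
      (fderiv_fderiv_conformalFactor_eq_zero hn g hg_symm hg_nondeg hv hφ hconf) x a
  have hinj : Function.Injective g := (injective_iff_map_eq_zero g).2 fun x hx ↦
    hg_nondeg x fun y ↦ by simp [hx]
  have hsurj : Function.Surjective g :=
    (LinearMap.injective_iff_surjective_of_finrank_eq_finrank
      (Subspace.dual_finrank_eq (K := ℝ) (V := V)).symm).1 hinj
  obtain ⟨u, hu⟩ := hsurj (fderiv ℝ φ a : V →ₗ[ℝ] ℝ)
  have hu' (x y : V) : fderiv ℝ φ x y = g u y := by rw [hu, hconst]; rfl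
  have second (x w y : V) : fderiv ℝ (fderiv ℝ v) x w y =
      (1 / 2 : ℝ) • (g u w • y + g u y • w - g w y • u) := by
    refine hinj (LinearMap.ext fun z ↦ ?_)
    have := fderiv_fderiv_conformal g hg_symm hv hφ hconf x w y z
    simp only [hu'] at this
    simp only [map_smul, map_sub, map_add, LinearMap.smul_apply, LinearMap.sub_apply,
      LinearMap.add_apply, smul_eq_mul]
    linarith
  set Q : V →L[ℝ] V →L[ℝ] V := fderiv ℝ (fderiv ℝ v) a with hQ
  have hQx (x : V) : fderiv ℝ (fderiv ℝ v) x = Q := by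
    ext w y
    rw [second, hQ, second]
  have hF1 (x : V) : fderiv ℝ v x = fderiv ℝ v a + Q (x - a) := by
    have hder (p : V) : HasFDerivAt (𝕜 := ℝ) (fun p ↦ fderiv ℝ v p - Q (p - a)) 0 p := by
      have h1 := ((hF.differentiable (by simp)) p).hasFDerivAt
      have h2 := Q.hasFDerivAt.comp p ((hasFDerivAt_id (𝕜 := ℝ) p).sub_const a)
      have h3 := h1.sub h2
      rw [hQx] at h3
      exact h3.congr_fderiv (by ext; simp)
    have := is_const_of_fderiv_eq_zero (𝕜 := ℝ) (fun p ↦ (hder p).differentiableAt)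
      (fun p ↦ (hder p).fderiv) x a
    simp only [sub_self, map_zero, sub_zero] at this
    rw [← this]; abel
  have hv1 (x : V) : v x = v a + fderiv ℝ v a (x - a) + (1 / 2 : ℝ) • Q (x - a) (x - a) := by
    have hder (p : V) : HasFDerivAt (𝕜 := ℝ)
        (fun p ↦ v p - fderiv ℝ v a (p - a) - (1 / 2 : ℝ) • Q (p - a) (p - a)) 0 p := by
      have h0 := (hasFDerivAt_id (𝕜 := ℝ) p).sub_const a
      have h1 := ((hv.differentiable (by simp)) p).hasFDerivAt
      have h2 := (fderiv ℝ v a).hasFDerivAt.comp p h0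
      have h3 := ((Q.hasFDerivAt.comp p h0).clm_apply h0).const_smul (1 / 2 : ℝ)
      refine ((h1.sub h2).sub h3).congr_fderiv ?_
      ext w
      have hs (q : V) : Q w q = Q q w := by
        rw [hQ, second, second, hg_symm w]
        module
      rw [hF1 p]
      simp [hs p, hs a]
      module
    have := is_const_of_fderiv_eq_zero (𝕜 := ℝ) (fun p ↦ (hder p).differentiableAt)
      (fun p ↦ (hder p).fderiv) x a
    simp only [sub_self, map_zero, sub_zero, smul_zero] at this
    rw [← this]; abel
  refine ⟨u, fun d ↦ ⟨?_, fun z ↦ ?_, ?_⟩⟩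
  · have hder (p : V) : HasFDerivAt (𝕜 := ℝ) (fun p ↦ φ p - fderiv ℝ φ a (p - a)) 0 p := by
      have h1 := ((hφ.differentiable (by simp)) p).hasFDerivAt
      have h2 := (fderiv ℝ φ a).hasFDerivAt.comp p ((hasFDerivAt_id (𝕜 := ℝ) p).sub_const a)
      have h3 := h1.sub h2
      rw [hconst p] at h3
      exact h3.congr_fderiv (by ext; simp)
    have := is_const_of_fderiv_eq_zero (𝕜 := ℝ) (fun p ↦ (hder p).differentiableAt)
      (fun p ↦ (hder p).fderiv) (a + d) a
    simp only [sub_self, map_zero, sub_zero, add_sub_cancel_left, hu'] at this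
    linarith
  · rw [hF1, add_sub_cancel_left, add_apply, hQ, second]
  · rw [hv1, add_sub_cancel_left, hQ, second]
    module

end Conformal

/-- Let `A` be a conformal endomorphism with factor `c`, and suppose that the vector `d` solves
the equation for a zero of the conformal field `d ↦ A d + g(u,d)d/2 - g(d,d)u/4`. If the conformal
factor at `d` equals `c`, then the derivative at `d` has the same characteristic polynomial
as `A`. -/
theorem charpoly_eq_of_conformal_zero {V : Type*} [AddCommGroup V] [Module ℝ V]
    [FiniteDimensional ℝ V] (g : V →ₗ[ℝ] V →ₗ[ℝ] ℝ) (hg_symm : ∀ x y : V, g x y = g y x)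
    {A B : Module.End ℝ V} {c : ℝ} {d u : V}
    (hA : ∀ y z, g (A y) z + g y (A z) = c * g y z)
    (hud : g u d = 0) (hd : A d = (1 / 4 : ℝ) • (g d d • u))
    (hB : ∀ z, B z = A z + (1 / 2 : ℝ) • (g u z • d - g d z • u)) :
    B.charpoly = A.charpoly := by
  have hdu : g d u = 0 := by rw [hg_symm, hud]
  by_cases hq : g d d = 0
  · have hAd : A d = 0 := by rw [hd, hq]; simp
    have h0 : B = (A + (1 / 2 : ℝ) • (g u).smulRight d) + (-(1 / 2 : ℝ)) • (g d).smulRight u := by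
      ext z
      simp only [hB, LinearMap.add_apply, LinearMap.smul_apply, LinearMap.smulRight_apply]
      module
    rw [h0, charpoly_add_eq_of_mul_eq_smul' c, charpoly_add_eq_of_mul_eq_smul 0]
    · ext z; simp [hAd]
    · ext z; simp [hud]
    · ext z
      have := hA d z
      simp only [hAd, map_zero, LinearMap.zero_apply, zero_add] at this
      simp [this, hq, mul_smul, smul_comm c]
    · ext z; simp [hdu]
  · have hc : c = 0 := by
      have := hA d d
      simp only [hd, map_smul, LinearMap.smul_apply, hud, hdu, smul_eq_mul, mul_zero, add_zero]
        at this
      simpa [hq] using this.symm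
    refine charpoly_eq_of_involution (R := 1 - (2 / g d d) • (g d).smulRight d) ?_ ?_
    · ext z
      simp
      match_scalars
      · ring
      · field_simp
        ring
    · ext z
      have := hA d z
      rw [hd, hc] at this
      simp only [map_smul, LinearMap.smul_apply, smul_eq_mul] at this
      have hz : g d (A z) = - (1 / 4) * (g d d * g u z) := by linarith
      simp [hB, hd, hz, hud]
      match_scalars <;> field_simp <;> ring

/-- For a smooth conformal vector field `v` with conformal factor
`φ` on a pseudo-Euclidean space of dimension `n ≥ 3`, the characteristic
polynomial of `Dv` and the value of `φ` are constant on every connected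
component of the zero set `Z = {x | v x = 0}`. -/
theorem stmt14
    {V : Type*} [NormedAddCommGroup V] [NormedSpace ℝ V] [FiniteDimensional ℝ V]
    (hn : 3 ≤ Module.finrank ℝ V)
    (g : V →ₗ[ℝ] V →ₗ[ℝ] ℝ)
    (hg_symm : ∀ x y : V, g x y = g y x)
    (hg_nondeg : ∀ x : V, (∀ y : V, g x y = 0) → x = 0)
    (v : V → V) (hv : ContDiff ℝ (⊤ : ℕ∞) v)
    (φ : V → ℝ)
    (hconf : ∀ x y z : V,
      g (fderiv ℝ v x y) z + g y (fderiv ℝ v x z) = φ x * g y z)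
    (x y : V) (hx : v x = 0)
    (hy : y ∈ connectedComponentIn {p : V | v p = 0} x) :
    LinearMap.charpoly (fderiv ℝ v x : V →ₗ[ℝ] V) =
      LinearMap.charpoly (fderiv ℝ v y : V →ₗ[ℝ] V) ∧
    φ x = φ y := by
  have hφ := contDiff_conformalFactor hn g hg_symm hg_nondeg hv hconf
  obtain ⟨u, hu⟩ := exists_quadratic_form_of_conformal hn g hg_symm hg_nondeg hv hφ hconf x
  have zero_eq (d : V) (hd : v (x + d) = 0) :
      fderiv ℝ v x d = (1 / 4 : ℝ) • (g d d • u) - (1 / 2 : ℝ) • (g u d • d) := by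
    have := (hu d).2.2
    rw [hd, hx, zero_add] at this
    rw [eq_sub_iff_add_eq]
    exact (sub_eq_zero.1 this.symm)
  have hfin : (φ '' {p : V | v p = 0}).Finite := by
    refine (((Set.finite_singleton (φ x)).insert (-φ x)).union
      ((Module.End.finite_hasEigenvalue (fderiv ℝ v x : V →ₗ[ℝ] V)).image
        fun μ ↦ φ x - 2 * μ)).subset ?_
    rintro _ ⟨p, hp, rfl⟩
    obtain ⟨d, rfl⟩ : ∃ d, p = x + d := ⟨p - x, by simp⟩
    have hd := zero_eq d hp
    rw [(hu d).1]
    by_cases hd0 : d = 0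
    · simp [hd0]
    by_cases hq : g d d = 0
    · right
      refine ⟨-(1 / 2) * g u d, Module.End.hasEigenvalue_of_hasEigenvector (x := d) ?_, by ring⟩
      refine Module.End.hasEigenvector_iff.2 ⟨Module.End.mem_eigenspace_iff.2 ?_, hd0⟩
      rw [ContinuousLinearMap.coe_coe, hd, hq]
      module
    · left; left
      have h1 := hconf x d d
      rw [hg_symm _ d, hd] at h1
      simp only [map_sub, map_smul, smul_eq_mul, hg_symm d u] at h1
      have h2 : g d d * (2 * φ x + g u d) = 0 := by linarith
      have h3 := (mul_eq_zero.1 h2).resolve_left hq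
      linarith
  have hφxy : φ x = φ y := by
    have hsub := connectedComponentIn_subset {p : V | v p = 0} x
    refine (hfin.countable.isTotallyDisconnected) _ (Set.image_mono hsub)
      (isPreconnected_connectedComponentIn.image _ hφ.continuous.continuousOn)
      (Set.mem_image_of_mem _ (mem_connectedComponentIn hx)) (Set.mem_image_of_mem _ hy)
  have hvy : v y = 0 := connectedComponentIn_subset {p : V | v p = 0} x hy
  obtain ⟨d, rfl⟩ : ∃ d, y = x + d := ⟨y - x, by simp⟩
  have hud : g u d = 0 := by linarith [(hu d).1]
  refine ⟨(charpoly_eq_of_conformal_zero g hg_symm (c := φ x) (d := d) (u := u) (hconf x) hud ?_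
    fun z ↦ ?_).symm, hφxy⟩
  · rw [ContinuousLinearMap.coe_coe, zero_eq d hvy, hud]
    simp
  · rw [ContinuousLinearMap.coe_coe, (hu d).2.1, hud]
    simp
end

section
/- Let (V,g) be a pseudo-Euclidean space of dimension n ≥ 3 and let v be a smooth conformal vector field on (V,g) with conformal factor φ : V → ℝ. Let a, b ∈ V with g(b,b) = 0, and suppose that for every t ∈ [0,1] the vector v(a + t·b) is a scalar multiple of b (v is tangent to the null line segment t ↦ a + t·b) and φ(a + t·b) = φ(a). Then charpoly(Dv_{a + t·b}) = charpoly(Dv_a) for every t ∈ [0,1]. -/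
open Polynomial in
/-- Perturbing an endomorphism by one that is strictly triangular with respect to an invariant flag
`span b ≤ ker f ≤ W` does not change the characteristic polynomial. -/
theorem LinearMap.charpoly_add_of_strict_flag {K W : Type*} [Field K] [Infinite K]
    [AddCommGroup W] [Module K W] [FiniteDimensional K W] (L N : W →ₗ[K] W) (b : W)
    (f : W →ₗ[K] K) {l m : K} (hLb : L b = l • b) (hfL : ∀ z, f (L z) = m * f z)
    (hNb : N b = 0) (hfN : ∀ z, f (N z) = 0) (hN : ∀ z, f z = 0 → ∃ k : K, N z = k • b) :
    (L + N).charpoly = L.charpoly := by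
  classical
  have hS : (L.charpoly * (X - C l) * (X - C m)) ≠ 0 :=
    mul_ne_zero (mul_ne_zero L.charpoly_monic.ne_zero (X_sub_C_ne_zero l)) (X_sub_C_ne_zero m)
  have hinf : ((↑(L.charpoly * (X - C l) * (X - C m)).roots.toFinset : Set K)ᶜ).Infinite :=
    (Finset.finite_toSet _).infinite_compl
  refine Polynomial.eq_of_infinite_eval_eq _ _ (hinf.mono fun c hc => ?_)
  have hc' : L.charpoly.eval c ≠ 0 ∧ c - l ≠ 0 ∧ c - m ≠ 0 := by
    have : ¬ (L.charpoly * (X - C l) * (X - C m)).eval c = 0 := by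
      simpa [hS, Polynomial.IsRoot] using hc
    simpa [not_or, and_assoc] using this
  obtain ⟨hcL, hcl, hcm⟩ := hc'
  set M : W →ₗ[K] W := algebraMap K (Module.End K W) c - L with hM
  have hMapply (z : W) : M z = c • z - L z := by simp [hM, Module.algebraMap_end_apply]
  have hMdet : LinearMap.det M ≠ 0 := by rwa [hM, ← LinearMap.eval_charpoly]
  obtain ⟨U, hU⟩ : ∃ U : W →ₗ[K] W, M * U = 1 ∧ U * M = 1 := by
    obtain ⟨u, hu⟩ := (LinearMap.isUnit_iff_isUnit_det M).2 hMdet.isUnit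
    exact ⟨(u⁻¹ : (Module.End K W)ˣ), by rw [← hu]; simp, by rw [← hu]; simp⟩
  have hMU (z : W) : M (U z) = z := LinearMap.congr_fun hU.1 z
  have hUM (z : W) : U (M z) = z := LinearMap.congr_fun hU.2 z
  have hUb : U b = (c - l)⁻¹ • b := by
    have h : M b = (c - l) • b := by rw [hMapply, hLb, sub_smul]
    rw [eq_inv_smul_iff₀ hcl, ← map_smul, ← h, hUM]
  have hfU (z : W) (hz : f z = 0) : f (U z) = 0 := by
    have h : f (M (U z)) = (c - m) * f (U z) := by
      rw [hMapply, map_sub, map_smul, hfL, smul_eq_mul, sub_mul]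
    rw [hMU, hz] at h
    exact (mul_eq_zero.1 h.symm).resolve_left hcm
  have hnil : IsNilpotent (U * N) := by
    refine ⟨3, LinearMap.ext fun z => ?_⟩
    obtain ⟨k, hk⟩ := hN (U (N z)) (hfU _ (hfN z))
    simp [pow_succ, hk, hUb, hNb]
  have hdet : LinearMap.det (1 - U * N) = 1 := by
    have h := LinearMap.eval_charpoly (U * N) 1
    rw [(LinearMap.charpoly_eq_X_pow_iff (U * N)).2
      (fun z => hnil.imp fun n hn => by rw [hn]; rfl)] at h
    simpa using h.symm
  have hfac : algebraMap K (Module.End K W) c - (L + N) = M * (1 - U * N) := by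
    rw [mul_sub, mul_one, ← mul_assoc, hU.1, one_mul, hM, sub_sub]
  change (L + N).charpoly.eval c = L.charpoly.eval c
  rw [LinearMap.eval_charpoly, LinearMap.eval_charpoly, hfac, map_mul, hdet, mul_one]

section Segment

variable {V : Type*} [NormedAddCommGroup V] [NormedSpace ℝ V]

theorem hasDerivAt_comp_segment {F : V → ℝ} (hF : Differentiable ℝ F) (a b : V) (t : ℝ) :
    HasDerivAt (fun t : ℝ => F (a + t • b)) (fderiv ℝ F (a + t • b) b) t := by
  have h : HasDerivAt (fun t : ℝ => a + t • b) b t := by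
    simpa using ((hasDerivAt_id t).smul_const b).const_add a
  exact (hF (a + t • b)).hasFDerivAt.comp_hasDerivAt t h

theorem fderiv_eq_zero_of_const_on_segment {F : V → ℝ} (hF : Differentiable ℝ F) {a b : V}
    {c : ℝ} (hc : ∀ t ∈ Set.Icc (0 : ℝ) 1, F (a + t • b) = c) {t : ℝ}
    (ht : t ∈ Set.Icc (0 : ℝ) 1) : fderiv ℝ F (a + t • b) b = 0 :=
  (uniqueDiffOn_Icc zero_lt_one t ht).eq_deriv _
    (hasDerivAt_comp_segment hF a b t).hasDerivWithinAt
    ((hasDerivWithinAt_const t _ c).congr hc (hc t ht))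

theorem const_on_segment_of_fderiv_eq_zero {F : V → ℝ} (hF : Differentiable ℝ F) {a b : V}
    (hd : ∀ t ∈ Set.Icc (0 : ℝ) 1, fderiv ℝ F (a + t • b) b = 0) {t : ℝ}
    (ht : t ∈ Set.Icc (0 : ℝ) 1) : F (a + t • b) = F a := by
  have h := constant_of_has_deriv_right_zero (f := fun t : ℝ => F (a + t • b))
    (fun s _ => (hasDerivAt_comp_segment hF a b s).continuousAt.continuousWithinAt)
    (fun s hs => by
      simpa [hd s (Set.Ico_subset_Icc_self hs)] using
        (hasDerivAt_comp_segment hF a b s).hasDerivWithinAt (s := Set.Ici s)) t ht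
  simpa using h

end Segment

/-- A vector orthogonal to the orthogonal complement of `b` is a multiple of `b`. -/
theorem exists_eq_smul_of_orthogonal_orthogonal {V : Type*} [AddCommGroup V] [Module ℝ V]
    {g : V →ₗ[ℝ] V →ₗ[ℝ] ℝ} (hg_nondeg : ∀ x : V, (∀ y : V, g x y = 0) → x = 0)
    {b y₀ u : V} (hy₀ : g b y₀ ≠ 0)
    (hu : ∀ y, g b y = 0 → g u y = 0) : ∃ k : ℝ, u = k • b := by
  refine ⟨g u y₀ / g b y₀, sub_eq_zero.1 (hg_nondeg _ fun y => ?_)⟩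
  have h := hu (y - (g b y / g b y₀) • y₀) (by simp [hy₀])
  simp only [map_sub, map_smul, smul_eq_mul, LinearMap.sub_apply, LinearMap.smul_apply] at h ⊢
  rw [← h]
  ring

/-- The second derivative of a conformal vector field is determined by the derivative of its
conformal factor. -/
theorem conformal_second_fderiv {V : Type*} [NormedAddCommGroup V] [NormedSpace ℝ V]
    [FiniteDimensional ℝ V] {g : V →ₗ[ℝ] V →ₗ[ℝ] ℝ} (hg_symm : ∀ x y : V, g x y = g y x)
    {v : V → V} (hv : ContDiff ℝ (⊤ : ℕ∞) v) {φ : V → ℝ} (hφ : Differentiable ℝ φ)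
    (hconf : ∀ x y z : V, g (fderiv ℝ v x y) z + g y (fderiv ℝ v x z) = φ x * g y z)
    (p x y z : V) :
    2 * g (fderiv ℝ (fderiv ℝ v) p x y) z =
      fderiv ℝ φ p x * g y z + fderiv ℝ φ p y * g x z - fderiv ℝ φ p z * g x y := by
  have hdv : Differentiable ℝ (fderiv ℝ v) :=
    ((contDiff_infty.1 hv 2).fderiv_right (m := 1) (by norm_num)).differentiable one_ne_zero
  have hsymm (x y : V) :
      fderiv ℝ (fderiv ℝ v) p x y = fderiv ℝ (fderiv ℝ v) p y x :=
    ((contDiff_infty.1 hv 2).contDiffAt.isSymmSndFDerivAt (by simp)).eq x y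
  have key (x y z : V) : g (fderiv ℝ (fderiv ℝ v) p x y) z +
      g (fderiv ℝ (fderiv ℝ v) p x z) y = fderiv ℝ φ p x * g y z := by
    have hd (y z : V) := (LinearMap.toContinuousLinearMap (g z)).hasFDerivAt.comp p
      (((ContinuousLinearMap.apply ℝ V y).hasFDerivAt).comp p (hdv p).hasFDerivAt)
    have h1 := (hd y z).add (hd z y)
    have h2 := (hφ p).hasFDerivAt.mul_const (g y z)
    have h3 := h1.unique (h2.congr_of_eventuallyEq (.of_forall fun q => by
      change g z (fderiv ℝ v q y) + g y (fderiv ℝ v q z) = φ q * g y z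
      rw [← hconf q y z, hg_symm z]))
    have h4 := congrArg (fun T => T x) h3
    change g z (fderiv ℝ (fderiv ℝ v) p x y) + g y (fderiv ℝ (fderiv ℝ v) p x z) =
      g y z * fderiv ℝ φ p x at h4
    rw [hg_symm _ z, hg_symm _ y, h4, mul_comm]
  have e1 := key x y z
  have e2 := key y x z
  have e3 := key z x y
  rw [hsymm y x] at e2
  rw [hsymm z x, hsymm z y] at e3
  linarith


/-- If a smooth conformal vector field `v` with conformal factor
`φ` on a pseudo-Euclidean space of dimension `n ≥ 3` is tangent to the null
segment `t ↦ a + t·b` (`g(b,b) = 0`) for `t ∈ [0,1]`, and `φ` is constant along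
the segment, then the characteristic polynomial of `Dv` is constant along the
segment. -/
theorem stmt15
    {V : Type*} [NormedAddCommGroup V] [NormedSpace ℝ V] [FiniteDimensional ℝ V]
    (hn : 3 ≤ Module.finrank ℝ V)
    (g : V →ₗ[ℝ] V →ₗ[ℝ] ℝ)
    (hg_symm : ∀ x y : V, g x y = g y x)
    (hg_nondeg : ∀ x : V, (∀ y : V, g x y = 0) → x = 0)
    (v : V → V) (hv : ContDiff ℝ (⊤ : ℕ∞) v)
    (φ : V → ℝ)
    (hconf : ∀ x y z : V,
      g (fderiv ℝ v x y) z + g y (fderiv ℝ v x z) = φ x * g y z)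
    (a b : V) (hb_null : g b b = 0)
    (htangent : ∀ t ∈ Set.Icc (0 : ℝ) 1, ∃ s : ℝ, v (a + t • b) = s • b)
    (hφconst : ∀ t ∈ Set.Icc (0 : ℝ) 1, φ (a + t • b) = φ a) :
    ∀ t ∈ Set.Icc (0 : ℝ) 1,
      LinearMap.charpoly (fderiv ℝ v (a + t • b) : V →ₗ[ℝ] V) =
        LinearMap.charpoly (fderiv ℝ v a : V →ₗ[ℝ] V) := by
  intro t ht
  obtain rfl | hb := eq_or_ne b 0
  · simp
  obtain ⟨y₀, hy₀⟩ : ∃ y₀, g b y₀ ≠ 0 := by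
    by_contra! h
    exact hb (hg_nondeg b h)
  have hdv : Differentiable ℝ (fderiv ℝ v) :=
    ((contDiff_infty.1 hv 2).fderiv_right (m := 1) (by norm_num)).differentiable one_ne_zero
  have hFd (z y p : V) : HasFDerivAt (fun p => g y (fderiv ℝ v p z))
      ((LinearMap.toContinuousLinearMap (g y)).comp
        ((ContinuousLinearMap.apply ℝ V z).comp (fderiv ℝ (fderiv ℝ v) p))) p :=
    (LinearMap.toContinuousLinearMap (g y)).hasFDerivAt.comp p
      (((ContinuousLinearMap.apply ℝ V z).hasFDerivAt).comp p (hdv p).hasFDerivAt)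
  have hφ : Differentiable ℝ φ := by
    have h : φ = fun p => (g y₀ (fderiv ℝ v p b) + g b (fderiv ℝ v p y₀)) * (g b y₀)⁻¹ := by
      funext p
      rw [← div_eq_mul_inv, eq_div_iff hy₀, ← hconf p b y₀, hg_symm y₀]
    rw [h]
    intro p
    exact ((hFd b y₀ p).differentiableAt.fun_add (hFd y₀ b p).differentiableAt).mul_const _
  have hφb (s : ℝ) (hs : s ∈ Set.Icc (0 : ℝ) 1) : fderiv ℝ φ (a + s • b) b = 0 :=
    fderiv_eq_zero_of_const_on_segment hφ hφconst hs
  have hconst (z y : V) (hzy : g b z = 0 ∧ g b y = 0 ∨ z = b) :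
      g (fderiv ℝ v (a + t • b) z) y = g (fderiv ℝ v a z) y := by
    rw [hg_symm, hg_symm _ y]
    refine const_on_segment_of_fderiv_eq_zero (F := fun p => g y (fderiv ℝ v p z))
      (fun p => (hFd z y p).differentiableAt) (fun s hs => ?_) ht
    have h := conformal_second_fderiv hg_symm hv hφ hconf (a + s • b) b z y
    rw [(hFd z y _).fderiv]
    change g y (fderiv ℝ (fderiv ℝ v) (a + s • b) b z) = 0
    rw [hg_symm]
    rcases hzy with ⟨hz, hy⟩ | rfl
    · rw [hφb s hs, hz, hy] at h
      linarith
    · rw [hφb s hs, hb_null] at h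
      linarith
  have hLb : fderiv ℝ v (a + t • b) b = fderiv ℝ v a b :=
    sub_eq_zero.1 (hg_nondeg _ fun y => by simp [hconst b y (.inr rfl)])
  obtain ⟨l, hl⟩ : ∃ l : ℝ, fderiv ℝ v a b = l • b := by
    refine exists_eq_smul_of_orthogonal_orthogonal hg_nondeg hy₀ fun y hy => ?_
    have hd (p : V) : HasFDerivAt (fun p => g y (v p))
        ((LinearMap.toContinuousLinearMap (g y)).comp (fderiv ℝ v p)) p :=
      (LinearMap.toContinuousLinearMap (g y)).hasFDerivAt.comp p
        (hv.differentiable (by simp) p).hasFDerivAt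
    have h := fderiv_eq_zero_of_const_on_segment (F := fun p => g y (v p)) (a := a) (b := b)
      (c := 0) (fun p => (hd p).differentiableAt) (fun s hs => by
        obtain ⟨k, hk⟩ := htangent s hs
        simp [hk, hg_symm y, hy]) (Set.left_mem_Icc.2 zero_le_one)
    rw [(hd _).fderiv] at h
    simpa [hg_symm y] using h
  have hfL (s : ℝ) (hs : s ∈ Set.Icc (0 : ℝ) 1) (h : fderiv ℝ v (a + s • b) b = l • b) (z : V) :
      g b (fderiv ℝ v (a + s • b) z) = (φ a - l) * g b z := by
    have := hconf (a + s • b) b z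
    rw [h, hφconst s hs] at this
    simp only [map_smul, LinearMap.smul_apply, smul_eq_mul] at this
    linarith
  have hfL₀ (z : V) : g b (fderiv ℝ v a z) = (φ a - l) * g b z := by
    simpa using hfL 0 (Set.left_mem_Icc.2 zero_le_one) (by simpa using hl) z
  have h := LinearMap.charpoly_add_of_strict_flag (fderiv ℝ v a : V →ₗ[ℝ] V)
    ((fderiv ℝ v (a + t • b) : V →ₗ[ℝ] V) - (fderiv ℝ v a : V →ₗ[ℝ] V)) b (g b)
    (l := l) (m := φ a - l) hl hfL₀ (by simp [hLb])
    (fun z => by simp [hfL t ht (hLb.trans hl) z, hfL₀ z])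
    (fun z hz => exists_eq_smul_of_orthogonal_orthogonal hg_nondeg hy₀ fun y hy => by
      simp [hconst z y (.inl ⟨hz, hy⟩)])
  rwa [add_sub_cancel] at h
end
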